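/- arXiv:2510.01930 — 4 statements merged into one kernel-verified Lean document; each statement's English description precedes it below -/
import Mathlib

section
/- Let λ ∈ ℝ, α > 0, and let g : [0,∞) → ℝ be any function. Suppose u, v : [0,∞) → ℝ are differentiable and satisfy u'(t) = −(1/2)·u(t)·(g(t) + λ), v'(t) = −(1/2)·v(t)·(−g(t) + λ) for all t ≥ 0, with initial condition u(0) = v(0) = α. Define w(t) := (u(t)² − v(t)²)/2. Then for every t ≥ 0, w is differentiable at t with w'(t) = −√(w(t)² + α⁴·exp(−2λt)) · g(t) − λ·w(t). -/
/-- If `u' = -(1/2) u (g + lam)` and `v' = -(1/2) v (-g + lam)` on `[0, ∞)`, then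
`u(t) v(t) = u(0) v(0) e^{-lam t}`. -/
theorem mul_eq_mul_exp_of_hasDerivAt (lam : ℝ) (g u v : ℝ → ℝ)
    (hu : ∀ t : ℝ, 0 ≤ t → HasDerivAt u (-(1/2) * u t * (g t + lam)) t)
    (hv : ∀ t : ℝ, 0 ≤ t → HasDerivAt v (-(1/2) * v t * (-(g t) + lam)) t)
    {t : ℝ} (ht : 0 ≤ t) : u t * v t = u 0 * v 0 * Real.exp (-lam * t) := by
  have hderiv : ∀ s : ℝ, 0 ≤ s → HasDerivAt (fun x => u x * v x * Real.exp (lam * x)) 0 s := by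
    intro s hs
    have hexp : HasDerivAt (fun x => Real.exp (lam * x)) (Real.exp (lam * s) * lam) s := by
      simpa using ((hasDerivAt_id s).const_mul lam).exp
    refine (((hu s hs).mul (hv s hs)).mul hexp).congr_deriv ?_
    simp only [Pi.mul_apply]
    ring
  have hconst := constant_of_has_deriv_right_zero
    (fun s hs => (hderiv s hs.1).continuousAt.continuousWithinAt)
    (fun s hs => (hderiv s hs.1).hasDerivWithinAt) t (Set.right_mem_Icc.mpr ht)
  simp only [mul_zero, Real.exp_zero, mul_one] at hconst
  rw [← hconst, mul_assoc, ← Real.exp_add]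
  simp

/-- For the diagonal linear network layer dynamics
`u' = -(1/2) u (g + lam)`, `v' = -(1/2) v (-g + lam)` with initialization
`u(0) = v(0) = α > 0`, the effective weight `w = (u² - v²)/2` satisfies
`w'(t) = -√(w(t)² + α⁴ e^{-2 lam t}) · g(t) - lam · w(t)` for all `t ≥ 0`. -/
theorem stmt_1 (lam α : ℝ) (hα : 0 < α) (g u v : ℝ → ℝ)
    (hu : ∀ t : ℝ, 0 ≤ t → HasDerivAt u (-(1/2) * u t * (g t + lam)) t)
    (hv : ∀ t : ℝ, 0 ≤ t → HasDerivAt v (-(1/2) * v t * (-(g t) + lam)) t)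
    (hu0 : u 0 = α) (hv0 : v 0 = α)
    (w : ℝ → ℝ) (hw : ∀ t : ℝ, w t = (u t ^ 2 - v t ^ 2) / 2) :
    ∀ t : ℝ, 0 ≤ t →
      HasDerivAt w
        (-Real.sqrt (w t ^ 2 + α ^ 4 * Real.exp (-2 * lam * t)) * g t - lam * w t) t := by
  intro t ht
  have hprod : α ^ 4 * Real.exp (-2 * lam * t) = (u t * v t) ^ 2 := by
    rw [mul_eq_mul_exp_of_hasDerivAt lam g u v hu hv ht, hu0, hv0, mul_pow, ← Real.exp_nat_mul]
    push_cast
    ring_nf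
  have hsqrt : Real.sqrt (w t ^ 2 + α ^ 4 * Real.exp (-2 * lam * t))
      = (u t ^ 2 + v t ^ 2) / 2 := by
    rw [hprod, hw t, ← Real.sqrt_sq (by positivity : 0 ≤ (u t ^ 2 + v t ^ 2) / 2)]
    congr 1
    ring
  rw [hsqrt, hw t, funext hw]
  refine ((((hu t ht).pow 2).sub ((hv t ht).pow 2)).div_const 2).congr_deriv ?_
  push_cast
  ring
end

section
/- Let w* ∈ ℝ with w* ≠ 0, let λ ≥ 0, set Δ := |w*| − λ, and assume Δ > 0. Let C > 0 and define w : [0,∞) → ℝ by w(τ) := sign(w*)·Δ/(1 + C·exp(−Δτ)). Then: (i) for all τ ≥ 0, w'(τ) = −|w(τ)|·(w(τ) − w*) − λ·w(τ); (ii) sign(w*)·Δ = ST(w*; λ); and (iii) for all τ ≥ 0, |w(τ) − sign(w*)·Δ| = Δ·C·exp(−Δτ)/(1 + C·exp(−Δτ)) ≤ Δ·C·exp(−Δτ), so w(τ) converges exponentially to ST(w*; λ) at rate Δ. -/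
/-- Soft-thresholding function `ST(x; τ) = sign(x) · max(|x| - τ, 0)`. -/
noncomputable def softThreshold (x τ : ℝ) : ℝ := Real.sign x * max (|x| - τ) 0

/-- The logistic solution `w(τ) = sign(w*) Δ / (1 + C e^{-Δτ})`
of the rich-phase ODE `w' = -|w|(w - w*) - λ w` (with `Δ = |w*| - λ > 0`, `C > 0`):
it solves the ODE, its limit `sign(w*) Δ` equals `ST(w*; λ)`, and it converges
exponentially to `ST(w*; λ)` at rate `Δ`. -/
theorem stmt_2 (wstar lam : ℝ) (hwstar : wstar ≠ 0) (hlam : 0 ≤ lam)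
    (Δ : ℝ) (hΔdef : Δ = |wstar| - lam) (hΔ : 0 < Δ)
    (C : ℝ) (hC : 0 < C)
    (w : ℝ → ℝ) (hw : ∀ τ : ℝ, w τ = Real.sign wstar * Δ / (1 + C * Real.exp (-Δ * τ))) :
    (∀ τ : ℝ, 0 ≤ τ →
        HasDerivAt w (-|w τ| * (w τ - wstar) - lam * w τ) τ) ∧
    Real.sign wstar * Δ = softThreshold wstar lam ∧
    (∀ τ : ℝ, 0 ≤ τ →
        |w τ - Real.sign wstar * Δ|
          = Δ * C * Real.exp (-Δ * τ) / (1 + C * Real.exp (-Δ * τ)) ∧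
        |w τ - Real.sign wstar * Δ| ≤ Δ * C * Real.exp (-Δ * τ)) := by
  have hD (τ : ℝ) : 0 < 1 + C * Real.exp (-Δ * τ) := by positivity
  have hsign : |Real.sign wstar| = 1 := by
    rcases Real.sign_apply_eq_of_ne_zero wstar hwstar with h | h <;> simp [h]
  have hw_abs (τ : ℝ) : |w τ| = Δ / (1 + C * Real.exp (-Δ * τ)) := by
    rw [hw, abs_div, abs_mul, hsign, one_mul, abs_of_pos hΔ, abs_of_pos (hD τ)]
  have hwstar_eq : wstar = Real.sign wstar * (Δ + lam) := by
    rw [hΔdef, sub_add_cancel]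
    rcases hwstar.lt_or_gt with h | h
    · rw [Real.sign_of_neg h, abs_of_neg h]
      ring
    · rw [Real.sign_of_pos h, abs_of_pos h, one_mul]
  have herror (τ : ℝ) : |w τ - Real.sign wstar * Δ|
      = Δ * C * Real.exp (-Δ * τ) / (1 + C * Real.exp (-Δ * τ)) := by
    have hne := (hD τ).ne'
    have hdiff : w τ - Real.sign wstar * Δ = -(Real.sign wstar *
        (Δ * C * Real.exp (-Δ * τ) / (1 + C * Real.exp (-Δ * τ)))) := by
      rw [hw]
      field_simp
      ring
    rw [hdiff, abs_neg, abs_mul, hsign, one_mul, abs_of_pos (by positivity)]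
  refine ⟨fun τ _ => ?_, ?_, fun τ _ => ⟨herror τ, ?_⟩⟩
  · have hne := (hD τ).ne'
    have hexp : HasDerivAt (fun t => 1 + C * Real.exp (-Δ * t))
        (C * (Real.exp (-Δ * τ) * (-Δ * 1))) τ :=
      ((((hasDerivAt_id τ).const_mul (-Δ)).exp).const_mul C).const_add 1
    rw [hw_abs, funext hw]
    refine ((hasDerivAt_const τ (Real.sign wstar * Δ)).div hexp hne).congr_deriv ?_
    generalize Real.sign wstar = s at hwstar_eq ⊢
    rw [hwstar_eq]
    field_simp
    ring
  · rw [softThreshold, ← hΔdef, max_eq_left hΔ.le]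
  · rw [herror]
    exact div_le_self (by positivity) (le_add_of_nonneg_right (by positivity))
end

section
/- Let λ ≥ 0 and w* ∈ ℝ with w* ≠ 0, and set a := |w*|, s := sign(w*). Define W : [0,∞) → ℝ by W(t) := (s/2)·(1 − exp(−2at))·exp((a − λ)t). Then: (i) W(0) = 0; (ii) for all t ≥ 0, √(W(t)² + exp(−2λt)) = (1/2)·(exp((a − λ)t) + exp(−(a + λ)t)); and (iii) for all t ≥ 0, W'(t) = w*·√(W(t)² + exp(−2λt)) − λ·W(t). -/
/-- The explicit search-phase solution
`W(t) = (s/2)(1 - e^{-2at}) e^{(a-λ)t}` with `a = |w*|`, `s = sign(w*)`: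
it vanishes at `t = 0`, satisfies the square-root identity
`√(W(t)² + e^{-2λt}) = (1/2)(e^{(a-λ)t} + e^{-(a+λ)t})`, and solves the ODE
`W' = w* √(W² + e^{-2λt}) - λ W`. -/
theorem stmt_4 (lam wstar : ℝ) (hlam : 0 ≤ lam) (hwstar : wstar ≠ 0)
    (a s : ℝ) (ha : a = |wstar|) (hs : s = Real.sign wstar)
    (W : ℝ → ℝ)
    (hW : ∀ t : ℝ, W t = s / 2 * (1 - Real.exp (-2 * a * t)) * Real.exp ((a - lam) * t)) :
    W 0 = 0 ∧
    (∀ t : ℝ, 0 ≤ t →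
      Real.sqrt (W t ^ 2 + Real.exp (-2 * lam * t))
        = 1 / 2 * (Real.exp ((a - lam) * t) + Real.exp (-(a + lam) * t))) ∧
    (∀ t : ℝ, 0 ≤ t →
      HasDerivAt W
        (wstar * Real.sqrt (W t ^ 2 + Real.exp (-2 * lam * t)) - lam * W t) t) := by
  have hs2 : s ^ 2 = 1 := by
    rcases hwstar.lt_or_gt with h | h
    · simp [hs, Real.sign_of_neg h]
    · simp [hs, Real.sign_of_pos h]
  have hsa : s * a = wstar := by
    rcases hwstar.lt_or_gt with h | h
    · simp [hs, ha, Real.sign_of_neg h, abs_of_neg h]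
    · simp [hs, ha, Real.sign_of_pos h, abs_of_pos h]
  have hW' : ∀ t, W t = s / 2 * (Real.exp ((a - lam) * t) - Real.exp (-(a + lam) * t)) := by
    intro t
    have h : Real.exp (-(a + lam) * t) = Real.exp (-2 * a * t) * Real.exp ((a - lam) * t) := by
      rw [← Real.exp_add]
      ring_nf
    rw [hW, h]
    ring
  have hsqrt : ∀ t, Real.sqrt (W t ^ 2 + Real.exp (-2 * lam * t))
      = 1 / 2 * (Real.exp ((a - lam) * t) + Real.exp (-(a + lam) * t)) := by
    intro t
    have h : Real.exp (-2 * lam * t) = Real.exp ((a - lam) * t) * Real.exp (-(a + lam) * t) := by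
      rw [← Real.exp_add]
      ring_nf
    rw [Real.sqrt_eq_iff_mul_self_eq_of_pos (by positivity), hW', h]
    linear_combination
      -(1 / 4 * (Real.exp ((a - lam) * t) - Real.exp (-(a + lam) * t)) ^ 2) * hs2
  refine ⟨by simp [hW], fun t _ => hsqrt t, fun t _ => ?_⟩
  have hexp : ∀ c : ℝ, HasDerivAt (fun x => Real.exp (c * x)) (Real.exp (c * t) * c) t :=
    fun c => (hasDerivAt_const_mul c).exp
  rw [hsqrt, hW', funext hW']
  refine (((hexp (a - lam)).sub (hexp (-(a + lam)))).const_mul (s / 2)).congr_deriv ?_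
  linear_combination
    1 / 2 * (Real.exp ((a - lam) * t) + Real.exp (-(a + lam) * t)) * hsa
end

section
/- Let δ > 0 and let μ be a Borel probability measure on ℝ. For α > 0 define x_α : ℝ → ℝ by x_α(w) := √(w² + α⁴). Let α₀ > 0 and suppose u : (0,∞) → ℝ is differentiable at α₀ and there is a neighborhood of α₀ on which u(α) ≠ 0, u(α) > −α², and ∫ (x_α(w)/(u(α) + x_α(w)))² dμ(w) = δ. Define γ(α) := (u(α)²/δ) · ∫ x_α(w)/(u(α) + x_α(w))² dμ(w). Then γ is differentiable at α₀ with γ'(α₀) = (2·α₀³·u(α₀)²/δ) · ∫ 1/( x_{α₀}(w)·(u(α₀) + x_{α₀}(w))² ) dμ(w), and in particular γ'(α₀) > 0. -/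
open MeasureTheory

lemma sq_le_sqrt_sq_add_pow_four (α w : ℝ) : α ^ 2 ≤ √(w ^ 2 + α ^ 4) :=
  Real.le_sqrt_of_sq_le (by nlinarith [sq_nonneg w])

lemma abs_sqrt_add_sub_sqrt_add_le (c a b : ℝ) (ha : 0 < a) (hb : 0 < b) (hc : 0 ≤ c) :
    |√(c + a ^ 2) - √(c + b ^ 2)| ≤ |a - b| := by
  have h₁ : a ≤ √(c + a ^ 2) := Real.le_sqrt_of_sq_le (by linarith)
  have h₂ : b ≤ √(c + b ^ 2) := Real.le_sqrt_of_sq_le (by linarith)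
  have hs : (√(c + a ^ 2) - √(c + b ^ 2)) * (√(c + a ^ 2) + √(c + b ^ 2))
      = (a - b) * (a + b) := by
    have e₁ := Real.sq_sqrt (show 0 ≤ c + a ^ 2 by positivity)
    have e₂ := Real.sq_sqrt (show 0 ≤ c + b ^ 2 by positivity)
    linear_combination e₁ - e₂
  have hs' := congrArg abs hs
  rw [abs_mul, abs_mul, abs_of_pos (show 0 < a + b by positivity),
    abs_of_pos (show 0 < √(c + a ^ 2) + √(c + b ^ 2) by linarith)] at hs'
  refine le_of_mul_le_mul_right ?_ (show 0 < a + b by positivity)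
  rw [← hs']
  gcongr

lemma abs_div_add_self_le {a v x ε M : ℝ} (hax : a ≤ x) (hε : 0 < ε) (hv : ε ≤ v + a)
    (hM : |v| ≤ M) : |x / (v + x)| ≤ 1 + M / ε := by
  have hpos : 0 < v + x := by linarith
  have hM0 : 0 ≤ M := (abs_nonneg v).trans hM
  have h : x / (v + x) = 1 - v / (v + x) := by
    field_simp
    ring
  rw [h]
  refine (abs_sub _ _).trans ?_
  rw [abs_one, abs_div, abs_of_pos hpos]
  gcongr
  linarith

lemma abs_self_div_add_le {a v x ε M : ℝ} (hax : a ≤ x) (hε : 0 < ε) (hv : ε ≤ v + a)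
    (hM : |v| ≤ M) : |v / (v + x)| ≤ M / ε := by
  have hM0 : 0 ≤ M := (abs_nonneg v).trans hM
  rw [abs_div, abs_of_pos (show 0 < v + x by linarith)]
  gcongr
  linarith

lemma mul_div_add_sub_mul_div_add {v x v' x' : ℝ} (h : v + x ≠ 0) (h' : v' + x' ≠ 0) :
    v * x / (v + x) - v' * x' / (v' + x') =
      x / (v + x) * (x' / (v' + x')) * (v - v') + v / (v + x) * (v' / (v' + x')) * (x - x') := by
  field_simp
  ring

lemma hasDerivAt_sqrt_sq_add_pow_four {α : ℝ} (hα : 0 < α) (w : ℝ) :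
    HasDerivAt (fun α : ℝ ↦ √(w ^ 2 + α ^ 4)) (2 * α ^ 3 / √(w ^ 2 + α ^ 4)) α := by
  have h : HasDerivAt (fun α : ℝ ↦ w ^ 2 + α ^ 4) (4 * α ^ 3) α := by
    simpa using (hasDerivAt_pow 4 α).const_add (w ^ 2)
  convert h.sqrt (by positivity) using 1
  have : 0 < √(w ^ 2 + α ^ 4) := Real.sqrt_pos.2 (by positivity)
  field_simp
  ring

lemma HasDerivAt.mul_div_add {f g : ℝ → ℝ} {f' g' t : ℝ} (hf : HasDerivAt f f' t)
    (hg : HasDerivAt g g' t) (h : f t + g t ≠ 0) :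
    HasDerivAt (fun t ↦ f t * g t / (f t + g t))
      ((g t / (f t + g t)) ^ 2 * f' + (f t / (f t + g t)) ^ 2 * g') t := by
  refine ((hf.mul hg).div (hf.add hg) h).congr_deriv ?_
  simp only [Pi.add_apply, Pi.mul_apply]
  field_simp
  ring

/-- Differentiation under the integral sign at a point, from a Lipschitz estimate centred at that
point. -/
lemma hasDerivAt_integral_of_eventually_abs_sub_le {Ω : Type*} [MeasurableSpace Ω]
    {μ : Measure Ω} [IsFiniteMeasure μ] {F : ℝ → Ω → ℝ} {F' : Ω → ℝ} {t₀ K : ℝ}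
    (hmeas : ∀ t, Measurable (F t)) (hint : Integrable (F t₀) μ) (hmeas' : Measurable F')
    (hlip : ∀ᶠ t in nhds t₀, ∀ w, |F t w - F t₀ w| ≤ K * |t - t₀|)
    (hderiv : ∀ w, HasDerivAt (F · w) (F' w) t₀) :
    HasDerivAt (fun t ↦ ∫ w, F t w ∂μ) (∫ w, F' w ∂μ) t₀ := by
  have hlim : Integrable F' μ := by
    refine Integrable.of_bound hmeas'.aestronglyMeasurable |K| (.of_forall fun w ↦ ?_)
    refine (hderiv w).le_of_lip' (abs_nonneg K) ?_
    filter_upwards [hlip] with t ht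
    exact (ht w).trans (by rw [Real.norm_eq_abs]; gcongr; exact le_abs_self K)
  let L : ℝ →L[ℝ] ℝ →L[ℝ] ℝ := ContinuousLinearMap.smulRightL ℝ ℝ ℝ 1
  have key := (hasFDerivAt_integral_of_dominated_loc_of_lip' (μ := μ) (F := F)
    (F' := fun w ↦ L (F' w)) (bound := fun _ ↦ K) hlip (fun t _ ↦ (hmeas t).aestronglyMeasurable)
    hint (L.continuous.comp_aestronglyMeasurable hmeas'.aestronglyMeasurable)
    (.of_forall fun w t ht ↦ ht w) (integrable_const K)
    (.of_forall fun w ↦ (hderiv w).hasFDerivAt)).2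
  rw [L.integral_comp_comm hlim] at key
  exact key

section ResolventIntegrals

variable {μ : Measure ℝ} [IsFiniteMeasure μ] {v α : ℝ}

lemma integrable_sqrt_div_add_sqrt_sq (h : 0 < v + α ^ 2) :
    Integrable (fun w ↦ (√(w ^ 2 + α ^ 4) / (v + √(w ^ 2 + α ^ 4))) ^ 2) μ := by
  refine .of_bound (Measurable.aestronglyMeasurable (by fun_prop)) ((1 + |v| / (v + α ^ 2)) ^ 2)
    (.of_forall fun w ↦ ?_)
  rw [norm_pow, Real.norm_eq_abs]
  gcongr
  exact abs_div_add_self_le (sq_le_sqrt_sq_add_pow_four α w) h le_rfl le_rfl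

lemma integrable_mul_sqrt_div_add_sqrt (h : 0 < v + α ^ 2) :
    Integrable (fun w ↦ v * √(w ^ 2 + α ^ 4) / (v + √(w ^ 2 + α ^ 4))) μ := by
  refine .of_bound (Measurable.aestronglyMeasurable (by fun_prop)) (|v| * (1 + |v| / (v + α ^ 2)))
    (.of_forall fun w ↦ ?_)
  rw [mul_div_assoc, norm_mul, Real.norm_eq_abs, Real.norm_eq_abs]
  gcongr
  exact abs_div_add_self_le (sq_le_sqrt_sq_add_pow_four α w) h le_rfl le_rfl

lemma integrable_one_div_sqrt_mul_add_sqrt_sq (hα : 0 < α) (h : 0 < v + α ^ 2) :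
    Integrable (fun w ↦ 1 / (√(w ^ 2 + α ^ 4) * (v + √(w ^ 2 + α ^ 4)) ^ 2)) μ := by
  refine .of_bound (Measurable.aestronglyMeasurable (by fun_prop))
    (1 / (α ^ 2 * (v + α ^ 2) ^ 2)) (.of_forall fun w ↦ ?_)
  have hx := sq_le_sqrt_sq_add_pow_four α w
  have hpos : 0 < v + √(w ^ 2 + α ^ 4) := by linarith
  rw [Real.norm_of_nonneg (by positivity)]
  gcongr

/-- The Legendre-type identity expressing the rate integral through `v x / (v + x)`. -/
lemma sq_mul_integral_sqrt_div_add_sqrt_sq (h : 0 < v + α ^ 2) :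
    v ^ 2 * ∫ w, √(w ^ 2 + α ^ 4) / (v + √(w ^ 2 + α ^ 4)) ^ 2 ∂μ =
      ∫ w, v * √(w ^ 2 + α ^ 4) / (v + √(w ^ 2 + α ^ 4)) ∂μ -
        v * ∫ w, (√(w ^ 2 + α ^ 4) / (v + √(w ^ 2 + α ^ 4))) ^ 2 ∂μ := by
  rw [← integral_const_mul, ← integral_const_mul, ← integral_sub
    (integrable_mul_sqrt_div_add_sqrt h) ((integrable_sqrt_div_add_sqrt_sq h).const_mul v)]
  refine integral_congr_ae (.of_forall fun w ↦ ?_)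
  have hpos : v + √(w ^ 2 + α ^ 4) ≠ 0 := by
    linarith [sq_le_sqrt_sq_add_pow_four α w]
  field_simp
  ring

lemma integral_one_div_sqrt_mul_add_sqrt_sq_pos [NeZero μ] (hα : 0 < α) (h : 0 < v + α ^ 2) :
    0 < ∫ w, 1 / (√(w ^ 2 + α ^ 4) * (v + √(w ^ 2 + α ^ 4)) ^ 2) ∂μ := by
  have hpos (w : ℝ) : 0 < 1 / (√(w ^ 2 + α ^ 4) * (v + √(w ^ 2 + α ^ 4)) ^ 2) := by
    have hx := sq_le_sqrt_sq_add_pow_four α w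
    have h₁ : 0 < v + √(w ^ 2 + α ^ 4) := by linarith
    have h₂ : 0 < √(w ^ 2 + α ^ 4) := lt_of_lt_of_le (by positivity) hx
    positivity
  rw [integral_pos_iff_support_of_nonneg (fun w ↦ (hpos w).le)
    (integrable_one_div_sqrt_mul_add_sqrt_sq hα h),
    Function.support_eq_univ (fun w ↦ (hpos w).ne')]
  exact Measure.measure_univ_pos.2 (NeZero.ne μ)

end ResolventIntegrals

lemma eventually_abs_mul_sqrt_div_add_sqrt_sub_le {u : ℝ → ℝ} {α₀ : ℝ} (hα₀ : 0 < α₀)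
    (hu : DifferentiableAt ℝ u α₀) (h : 0 < u α₀ + α₀ ^ 2) :
    ∃ K : ℝ, ∀ᶠ α in nhds α₀, ∀ w : ℝ,
      |u α * √(w ^ 2 + α ^ 4) / (u α + √(w ^ 2 + α ^ 4)) -
        u α₀ * √(w ^ 2 + α₀ ^ 4) / (u α₀ + √(w ^ 2 + α₀ ^ 4))| ≤ K * |α - α₀| := by
  obtain ⟨ε, hε, hεu⟩ := exists_between h
  obtain ⟨M, hM⟩ := exists_gt |u α₀|
  have hM0 : 0 < M := (abs_nonneg _).trans_lt hM
  obtain ⟨K, hK⟩ := hu.hasDerivAt.isBigO_sub.bound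
  have hc : ContinuousAt (fun α ↦ u α + α ^ 2) α₀ := hu.continuousAt.add (by fun_prop)
  refine ⟨(1 + M / ε) * (1 + M / ε) * K + M / ε * (M / ε) * (3 * α₀), ?_⟩
  filter_upwards [hK, hc.eventually_const_lt hεu, hu.continuousAt.abs.eventually_lt_const hM,
    lt_mem_nhds hα₀, gt_mem_nhds (show α₀ < 2 * α₀ by linarith)] with α hKα hεα hMα hα hα2 w
  have hx := sq_le_sqrt_sq_add_pow_four α w
  have hx₀ := sq_le_sqrt_sq_add_pow_four α₀ w
  have hsqrt : |√(w ^ 2 + α ^ 4) - √(w ^ 2 + α₀ ^ 4)| ≤ 3 * α₀ * |α - α₀| := by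
    have := abs_sqrt_add_sub_sqrt_add_le (w ^ 2) (α ^ 2) (α₀ ^ 2) (by positivity) (by positivity)
      (sq_nonneg w)
    rw [← pow_mul, ← pow_mul] at this
    refine this.trans ?_
    rw [sq_sub_sq, abs_mul, abs_of_pos (show 0 < α + α₀ by positivity)]
    gcongr
    linarith
  rw [mul_div_add_sub_mul_div_add (by linarith) (by linarith), add_mul, mul_assoc _ K,
    mul_assoc _ (3 * α₀)]
  refine (abs_add_le _ _).trans ?_
  simp only [abs_mul]
  gcongr
  · exact abs_div_add_self_le hx hε hεα.le hMα.le
  · exact abs_div_add_self_le hx₀ hε hεu.le hM.le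
  · exact hKα
  · exact abs_self_div_add_le hx hε hεα.le hMα.le
  · exact abs_self_div_add_le hx₀ hε hεu.le hM.le

/-- Monotonicity of the convergence rate in the initialization
scale. With `x_α(w) = √(w² + α⁴)`, suppose `u(α)` is differentiable at `α₀ > 0` and,
near `α₀`, satisfies `u(α) ≠ 0`, `u(α) > -α²`, and the constraint
`∫ (x_α/(u(α)+x_α))² dμ = δ`. Then
`γ(α) := (u(α)²/δ) ∫ x_α/(u(α)+x_α)² dμ` is differentiable at `α₀` with
`γ'(α₀) = (2α₀³ u(α₀)²/δ) ∫ 1/(x_{α₀} (u(α₀)+x_{α₀})²) dμ > 0`. -/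
theorem stmt_10 (δ : ℝ) (hδ : 0 < δ) (μ : Measure ℝ) [IsProbabilityMeasure μ]
    (α₀ : ℝ) (hα₀ : 0 < α₀) (u : ℝ → ℝ)
    (hdiff : DifferentiableAt ℝ u α₀)
    (hnear : ∀ᶠ α in nhds α₀,
      u α ≠ 0 ∧ -α ^ 2 < u α ∧
      ∫ w, (Real.sqrt (w ^ 2 + α ^ 4) / (u α + Real.sqrt (w ^ 2 + α ^ 4))) ^ 2 ∂μ = δ)
    (γ : ℝ → ℝ)
    (hγ : ∀ α : ℝ, γ α = u α ^ 2 / δ *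
      ∫ w, Real.sqrt (w ^ 2 + α ^ 4) / (u α + Real.sqrt (w ^ 2 + α ^ 4)) ^ 2 ∂μ) :
    HasDerivAt γ
      (2 * α₀ ^ 3 * u α₀ ^ 2 / δ *
        ∫ w, 1 / (Real.sqrt (w ^ 2 + α₀ ^ 4) *
          (u α₀ + Real.sqrt (w ^ 2 + α₀ ^ 4)) ^ 2) ∂μ) α₀ ∧
    0 < 2 * α₀ ^ 3 * u α₀ ^ 2 / δ *
        ∫ w, 1 / (Real.sqrt (w ^ 2 + α₀ ^ 4) *
          (u α₀ + Real.sqrt (w ^ 2 + α₀ ^ 4)) ^ 2) ∂μ := by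
  obtain ⟨hu₀, hlt₀, hδ₀⟩ := hnear.self_of_nhds
  have hpos₀ : 0 < u α₀ + α₀ ^ 2 := by linarith
  have hI := integral_one_div_sqrt_mul_add_sqrt_sq_pos (μ := μ) hα₀ hpos₀
  refine ⟨?_, by positivity⟩
  obtain ⟨K, hK⟩ := eventually_abs_mul_sqrt_div_add_sqrt_sub_le hα₀ hdiff hpos₀
  have hderiv := hasDerivAt_integral_of_eventually_abs_sub_le (μ := μ)
    (fun α ↦ by fun_prop) (integrable_mul_sqrt_div_add_sqrt hpos₀) (by fun_prop) hK
    fun w ↦ hdiff.hasDerivAt.mul_div_add (hasDerivAt_sqrt_sq_add_pow_four hα₀ w)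
      (by linarith [sq_le_sqrt_sq_add_pow_four α₀ w])
  have hγ' : γ =ᶠ[nhds α₀] fun α ↦
      (∫ w, u α * √(w ^ 2 + α ^ 4) / (u α + √(w ^ 2 + α ^ 4)) ∂μ - u α * δ) / δ := by
    filter_upwards [hnear] with α ⟨_, hlt, hc⟩
    rw [hγ, div_mul_eq_mul_div, sq_mul_integral_sqrt_div_add_sqrt_sq (by linarith), hc]
  refine (((hderiv.sub (hdiff.hasDerivAt.mul_const δ)).div_const δ).congr_of_eventuallyEq
    hγ').congr_deriv ?_
  have hsplit (w : ℝ) : (u α₀ / (u α₀ + √(w ^ 2 + α₀ ^ 4))) ^ 2 *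
      (2 * α₀ ^ 3 / √(w ^ 2 + α₀ ^ 4)) = 2 * α₀ ^ 3 * u α₀ ^ 2 *
        (1 / (√(w ^ 2 + α₀ ^ 4) * (u α₀ + √(w ^ 2 + α₀ ^ 4)) ^ 2)) := by
    rw [div_pow, div_mul_div_comm, mul_one_div]
    ring
  simp only [hsplit]
  rw [integral_add ((integrable_sqrt_div_add_sqrt_sq hpos₀).mul_const _)
    ((integrable_one_div_sqrt_mul_add_sqrt_sq hα₀ hpos₀).const_mul _), integral_mul_const,
    integral_const_mul, hδ₀]
  ring
end
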